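/- arXiv:2107.13864 — 9 statements merged into one kernel-verified Lean document; each statement's English description precedes it below -/
import Mathlib

section
/- Let F : ℝⁿ → ℝⁿ be differentiable and let x : ℝ → ℝⁿ be a differentiable curve satisfying the continuous Newton flow J(x(t)) · x'(t) = −F(x(t)) for all t ≥ t₀. Then the energy E(t) = ‖F(x(t))‖² tends to 0 as t → ∞, where ‖·‖ is the Euclidean norm on ℝⁿ. -/
/-- Along the continuous Newton flow `J(x(t)) ⬝ x'(t) = -F(x(t))`, the energy
`E(t) = ‖F(x(t))‖²` tends to `0` as `t → ∞`. -/
theorem newton_flow_energy_tendsto_zero (n : ℕ)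
    (F : EuclideanSpace ℝ (Fin n) → EuclideanSpace ℝ (Fin n))
    (x : ℝ → EuclideanSpace ℝ (Fin n)) (t₀ : ℝ)
    (hF : Differentiable ℝ F) (hx : Differentiable ℝ x)
    (hflow : ∀ t ≥ t₀, fderiv ℝ F (x t) (deriv x t) = -F (x t)) :
    Filter.Tendsto (fun t => ‖F (x t)‖ ^ 2) Filter.atTop (nhds 0) := by
  have hd : ∀ t ≥ t₀, HasDerivAt (fun t => Real.exp t • F (x t)) 0 t := by
    intro t ht
    have h1 : HasDerivAt (fun t => F (x t)) (-F (x t)) t := by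
      rw [← hflow t ht]
      exact (hF (x t)).hasFDerivAt.comp_hasDerivAt t (hx t).hasDerivAt
    have h2 := (Real.hasDerivAt_exp t).smul h1
    have h3 : Real.exp t • -F (x t) + Real.exp t • F (x t) = 0 := by simp
    rw [h3] at h2
    exact h2
  have hc : ∀ t ≥ t₀, Real.exp t • F (x t) = Real.exp t₀ • F (x t₀) := by
    intro T hT
    exact constant_of_has_deriv_right_zero (a := t₀) (b := T)
      (f := fun t => Real.exp t • F (x t))
      (fun s hs => (hd s hs.1).continuousAt.continuousWithinAt)
      (fun s hs => (hd s hs.1).hasDerivWithinAt) T ⟨hT, le_rfl⟩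
  have hlim : Filter.Tendsto (fun t => Real.exp (-t) • (Real.exp t₀ • F (x t₀)))
      Filter.atTop (nhds 0) := by
    have := (Real.tendsto_exp_neg_atTop_nhds_zero).smul_const (Real.exp t₀ • F (x t₀))
    simpa only [zero_smul] using this
  have hlim2 : Filter.Tendsto (fun t => F (x t)) Filter.atTop (nhds 0) := by
    refine hlim.congr' ?_
    filter_upwards [Filter.eventually_ge_atTop t₀] with t ht
    rw [← hc t ht, smul_smul, ← Real.exp_add]
    simp
  simpa using hlim2.norm.pow 2
end

section
/- Let F : ℝⁿ → ℝⁿ be differentiable with continuous F, and let x : ℝ → ℝⁿ be a differentiable curve satisfying the continuous Newton flow J(x(t)) · x'(t) = −F(x(t)) for all t ≥ t₀. If x* ∈ ℝⁿ is a limit point of the trajectory as t → ∞, i.e. there exists a sequence t_j → ∞ with x(t_j) → x*, then F(x*) = 0, so x* is a solution of the nonlinear system F(x) = 0. -/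
/-- Every limit point of a trajectory of the continuous Newton flow is a zero of `F`. -/
theorem newton_flow_limit_point_is_zero (n : ℕ)
    (F : EuclideanSpace ℝ (Fin n) → EuclideanSpace ℝ (Fin n))
    (x : ℝ → EuclideanSpace ℝ (Fin n)) (t₀ : ℝ)
    (hF : Differentiable ℝ F) (hFc : Continuous F) (hx : Differentiable ℝ x)
    (hflow : ∀ t ≥ t₀, fderiv ℝ F (x t) (deriv x t) = -F (x t))
    (xstar : EuclideanSpace ℝ (Fin n)) (tseq : ℕ → ℝ)
    (htseq : Filter.Tendsto tseq Filter.atTop Filter.atTop)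
    (hlim : Filter.Tendsto (fun j => x (tseq j)) Filter.atTop (nhds xstar)) :
    F xstar = 0 := by
  have hd : ∀ t ≥ t₀, HasDerivAt (fun s => Real.exp s • F (x s)) 0 t := by
    intro t ht
    have h1 : HasDerivAt (fun s => F (x s)) (-F (x t)) t := by
      rw [← hflow t ht]
      exact (hF (x t)).hasFDerivAt.comp_hasDerivAt t (hx t).hasDerivAt
    have h2 := (Real.hasDerivAt_exp t).smul h1
    have h3 : Real.exp t • (-F (x t)) + Real.exp t • F (x t) = 0 := by
      rw [smul_neg, neg_add_cancel]
    rw [h3] at h2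
    exact h2
  have hconst : ∀ t ≥ t₀, Real.exp t • F (x t) = Real.exp t₀ • F (x t₀) := by
    intro t ht
    exact constant_of_has_deriv_right_zero (f := fun s => Real.exp s • F (x s)) (a := t₀) (b := t)
      (fun s hs => (hd s hs.1).continuousAt.continuousWithinAt)
      (fun s hs => (hd s hs.1).hasDerivWithinAt) t ⟨ht, le_refl t⟩
  have hform : ∀ t ≥ t₀, Real.exp (-t) • (Real.exp t₀ • F (x t₀)) = F (x t) := by
    intro t ht
    rw [← hconst t ht, smul_smul, ← Real.exp_add, neg_add_cancel, Real.exp_zero, one_smul]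
  have hA : Filter.Tendsto (fun j => F (x (tseq j))) Filter.atTop (nhds (F xstar)) :=
    (hFc.tendsto xstar).comp hlim
  have hB : Filter.Tendsto (fun j => F (x (tseq j))) Filter.atTop (nhds 0) := by
    have h4 := ((Real.tendsto_exp_neg_atTop_nhds_zero.comp htseq).smul_const
      (Real.exp t₀ • F (x t₀)))
    rw [zero_smul] at h4
    refine h4.congr' ?_
    filter_upwards [htseq.eventually_ge_atTop t₀] with j hj
    exact hform _ hj
  exact tendsto_nhds_unique hA hB
end

section
/- Let F : ℝⁿ → ℝⁿ be differentiable and let x : ℝ → ℝⁿ be a differentiable curve satisfying the continuous Newton flow J(x(t)) · x'(t) = −F(x(t)) for all t ≥ t₀. If the initial point is not a solution of the nonlinear system, i.e. F(x(t₀)) ≠ 0, then for every finite time T ≥ t₀ one has F(x(T)) ≠ 0; that is, the trajectory cannot reach a solution of F(x) = 0 in finite time. -/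
/-- If the initial point of the continuous Newton flow is not a zero of `F`, the
trajectory cannot reach a zero of `F` in finite time. -/
theorem newton_flow_no_finite_time_convergence (n : ℕ)
    (F : EuclideanSpace ℝ (Fin n) → EuclideanSpace ℝ (Fin n))
    (x : ℝ → EuclideanSpace ℝ (Fin n)) (t₀ : ℝ)
    (hF : Differentiable ℝ F) (hx : Differentiable ℝ x)
    (hflow : ∀ t ≥ t₀, fderiv ℝ F (x t) (deriv x t) = -F (x t))
    (h0 : F (x t₀) ≠ 0) :
    ∀ T ≥ t₀, F (x T) ≠ 0 := by
  intro T hT hzero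
  have hd : ∀ t ≥ t₀, HasDerivAt (fun s => Real.exp s • F (x s)) 0 t := by
    intro t ht
    have h1 : HasDerivAt (fun s => F (x s)) (-F (x t)) t := by
      rw [← hflow t ht]
      exact (hF (x t)).hasFDerivAt.comp_hasDerivAt t (hx t).hasDerivAt
    have h2 := (Real.hasDerivAt_exp t).smul h1
    have h3 : Real.exp t • -F (x t) + Real.exp t • F (x t) = 0 := by
      rw [smul_neg, neg_add_cancel]
    rw [h3] at h2
    exact h2
  have hc := constant_of_has_deriv_right_zero (f := fun s => Real.exp s • F (x s))
    (a := t₀) (b := T)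
    (fun t ht => (hd t ht.1).continuousAt.continuousWithinAt)
    (fun t ht => (hd t ht.1).hasDerivWithinAt) T ⟨hT, le_refl T⟩
  simp only [hzero, smul_zero] at hc
  exact (smul_ne_zero (Real.exp_pos t₀).ne' h0) hc.symm
end

section
/- Let F : ℝⁿ → ℝⁿ be differentiable and let x : ℝ → ℝⁿ be a differentiable curve satisfying the continuous Newton flow J(x(t)) · x'(t) = −F(x(t)) for all t ≥ t₀, with F(x(t₀)) ≠ 0. Then the function t ↦ ‖F(x(t))‖ is strictly decreasing on [t₀, ∞), where ‖·‖ is the Euclidean norm on ℝⁿ. -/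
/-- Along the continuous Newton flow with a nonzero initial residual, the residual norm
`t ↦ ‖F(x(t))‖` is strictly decreasing on `[t₀, ∞)`. -/
theorem newton_flow_residual_strictAnti (n : ℕ)
    (F : EuclideanSpace ℝ (Fin n) → EuclideanSpace ℝ (Fin n))
    (x : ℝ → EuclideanSpace ℝ (Fin n)) (t₀ : ℝ)
    (hF : Differentiable ℝ F) (hx : Differentiable ℝ x)
    (hflow : ∀ t ≥ t₀, fderiv ℝ F (x t) (deriv x t) = -F (x t))
    (h0 : F (x t₀) ≠ 0) :
    StrictAntiOn (fun t => ‖F (x t)‖) (Set.Ici t₀) := by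
  have hd : ∀ t ≥ t₀, HasDerivAt (fun s => Real.exp s • F (x s)) 0 t := by
    intro t ht
    have h1 : HasDerivAt (fun s => F (x s)) (-F (x t)) t := by
      rw [← hflow t ht]
      exact (hF (x t)).hasFDerivAt.comp_hasDerivAt t (hx t).hasDerivAt
    have h2 := (Real.hasDerivAt_exp t).smul h1
    have h3 : Real.exp t • (-F (x t)) + Real.exp t • F (x t) = 0 := by
      rw [smul_neg, neg_add_cancel]
    rw [h3] at h2
    exact h2
  have hc : ∀ t ≥ t₀, Real.exp t • F (x t) = Real.exp t₀ • F (x t₀) := by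
    intro t ht
    exact constant_of_has_deriv_right_zero (f := fun s => Real.exp s • F (x s)) (a := t₀) (b := t)
      (fun s hs => (hd s hs.1).continuousAt.continuousWithinAt)
      (fun s hs => (hd s hs.1).hasDerivWithinAt) t ⟨ht, le_refl t⟩
  have hn : ∀ t ≥ t₀, Real.exp t * ‖F (x t)‖ = Real.exp t₀ * ‖F (x t₀)‖ := by
    intro t ht
    have h := congrArg norm (hc t ht)
    simpa [norm_smul] using h
  intro a ha b hb hab
  have hpos : 0 < Real.exp t₀ * ‖F (x t₀)‖ := mul_pos (Real.exp_pos _) (norm_pos_iff.mpr h0)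
  have h1 := hn a ha
  have h2 := hn b hb
  have he := Real.exp_lt_exp.mpr hab
  have hea := Real.exp_pos a
  change ‖F (x b)‖ < ‖F (x a)‖
  by_contra hle
  push Not at hle
  have hA : 0 < ‖F (x a)‖ := by
    rw [← h1] at hpos
    exact pos_of_mul_pos_right hpos hea.le
  nlinarith [mul_pos (sub_pos.mpr he) hA, mul_nonneg (Real.exp_pos b).le (sub_nonneg.mpr hle)]
end

section
/- (Lemma 1, deflation lower bound.) Let F : ℝⁿ → ℝⁿ be continuously differentiable, let x₁*, …, x_k* ∈ ℝⁿ, and suppose for some index i ∈ {1, …, k} that F(x_i*) = 0 and the Jacobian J(x_i*) satisfies ‖J(x_i*) y‖ ≥ c_l ‖y‖ for all y ∈ ℝⁿ, where c_l > 0. Define the deflated function G_k(x) = F(x) / (‖x − x₁*‖ ⋯ ‖x − x_k*‖) for x distinct from all x_j*. Then there exists δ_i > 0 such that for every x with ‖x − x_i*‖ ≤ δ_i and x ∉ {x₁*, …, x_k*}, one has ‖G_k(x)‖ ≥ (c_l/2) · 1 / (∏_{j ≠ i} ‖x − x_j*‖). -/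
open Finset in
/-- Lemma 1 (deflation lower bound): near a nondegenerate zero `x_i*` of `F`, the
deflated function `G_k(x) = F(x) / ∏_j ‖x - x_j*‖` satisfies
`‖G_k(x)‖ ≥ (c_l/2) / ∏_{j ≠ i} ‖x - x_j*‖`. -/
theorem deflation_lower_bound (n k : ℕ)
    (F : EuclideanSpace ℝ (Fin n) → EuclideanSpace ℝ (Fin n))
    (xs : Fin k → EuclideanSpace ℝ (Fin n)) (i : Fin k) (cl : ℝ)
    (hF : ContDiff ℝ 1 F) (hcl : 0 < cl) (hz : F (xs i) = 0)
    (hJ : ∀ y : EuclideanSpace ℝ (Fin n), cl * ‖y‖ ≤ ‖fderiv ℝ F (xs i) y‖) :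
    ∃ δ > 0, ∀ x : EuclideanSpace ℝ (Fin n),
      ‖x - xs i‖ ≤ δ → (∀ j, x ≠ xs j) →
        cl / 2 * (∏ j ∈ univ.erase i, ‖x - xs j‖)⁻¹ ≤
          ‖(∏ j, ‖x - xs j‖)⁻¹ • F x‖ := by
  have hd : HasFDerivAt F (fderiv ℝ F (xs i)) (xs i) :=
    (hF.differentiable (by norm_num) (xs i)).hasFDerivAt
  have ho := hd.isLittleO.def (half_pos hcl)
  obtain ⟨ε, hε, hb⟩ := Metric.eventually_nhds_iff.1 ho
  refine ⟨ε / 2, half_pos hε, fun x hx hne => ?_⟩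
  have h1 := hb (y := x) (by rw [dist_eq_norm]; linarith)
  rw [hz, sub_zero] at h1
  have h2 := hJ (x - xs i)
  have h3 := norm_sub_norm_le (fderiv ℝ F (xs i) (x - xs i)) (F x)
  rw [norm_sub_rev] at h3
  have h4 : cl / 2 * ‖x - xs i‖ ≤ ‖F x‖ := by linarith
  have hpos : ∀ j, 0 < ‖x - xs j‖ := fun j => norm_pos_iff.2 (sub_ne_zero.2 (hne j))
  have hP : 0 < ∏ j ∈ univ.erase i, ‖x - xs j‖ := Finset.prod_pos fun j _ => hpos j
  rw [← Finset.mul_prod_erase univ (fun j => ‖x - xs j‖) (mem_univ i), norm_smul, norm_inv,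
    Real.norm_of_nonneg (mul_pos (hpos i) hP).le, mul_inv]
  have h5 : cl / 2 ≤ ‖x - xs i‖⁻¹ * ‖F x‖ := by
    rw [inv_mul_eq_div, le_div_iff₀ (hpos i)]
    exact h4
  calc _ ≤ (‖x - xs i‖⁻¹ * ‖F x‖) * (∏ j ∈ univ.erase i, ‖x - xs j‖)⁻¹ :=
        mul_le_mul_of_nonneg_right h5 (inv_pos.2 hP).le
    _ = _ := by ring
end

section
/- (Deflation removes the zero.) Let F : ℝⁿ → ℝⁿ be continuously differentiable, let x₁*, …, x_k* ∈ ℝⁿ be pairwise distinct, and suppose for some index i ∈ {1, …, k} that F(x_i*) = 0 and ‖J(x_i*) y‖ ≥ c_l ‖y‖ for all y ∈ ℝⁿ with c_l > 0, where J is the Jacobian of F. Define G_k(x) = F(x) / (‖x − x₁*‖ ⋯ ‖x − x_k*‖) for x distinct from all x_j*. Then there exist δ > 0 and ε > 0 such that ‖G_k(x)‖ ≥ ε for all x with 0 < ‖x − x_i*‖ ≤ δ; in particular, G_k has no zero in the punctured ball {x : 0 < ‖x − x_i*‖ ≤ δ}. -/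
/-- Deflation removes the zero: the deflated function
`G_k(x) = F(x)/∏_j ‖x - x_j*‖` is uniformly bounded away from zero in a punctured
ball around the nondegenerate zero `x_i*`. -/
theorem deflation_removes_zero (n k : ℕ)
    (F : EuclideanSpace ℝ (Fin n) → EuclideanSpace ℝ (Fin n))
    (xs : Fin k → EuclideanSpace ℝ (Fin n)) (i : Fin k) (cl : ℝ)
    (hF : ContDiff ℝ 1 F) (hcl : 0 < cl) (hz : F (xs i) = 0)
    (hxs : Function.Injective xs)
    (hJ : ∀ y : EuclideanSpace ℝ (Fin n), cl * ‖y‖ ≤ ‖fderiv ℝ F (xs i) y‖) :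
    ∃ δ > 0, ∃ ε > 0, ∀ x : EuclideanSpace ℝ (Fin n),
      0 < ‖x - xs i‖ → ‖x - xs i‖ ≤ δ →
        ε ≤ ‖(∏ j, ‖x - xs j‖)⁻¹ • F x‖ := by
  classical
  set P : EuclideanSpace ℝ (Fin n) → ℝ :=
    fun x => ∏ j ∈ Finset.univ.erase i, ‖x - xs j‖ with hP
  have hPc : Continuous P := by
    rw [hP]; fun_prop
  have hP0 : 0 < P (xs i) := by
    rw [hP]
    refine Finset.prod_pos fun j hj => ?_
    rw [norm_pos_iff, sub_ne_zero]
    exact fun h => (Finset.ne_of_mem_erase hj) (hxs h).symm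
  have hprodA : ∀ x, ∏ j, ‖x - xs j‖ = ‖x - xs i‖ * P x := fun x =>
    (Finset.mul_prod_erase Finset.univ (fun j => ‖x - xs j‖) (Finset.mem_univ i)).symm
  clear_value P
  clear hP
  have e1 : ∀ᶠ x in nhds (xs i), 0 < P x := hPc.continuousAt.eventually (lt_mem_nhds hP0)
  have e2 : ∀ᶠ x in nhds (xs i), P x < P (xs i) + 1 :=
    hPc.continuousAt.eventually (gt_mem_nhds (lt_add_one _))
  have hd : HasFDerivAt F (fderiv ℝ F (xs i)) (xs i) :=
    ((hF.differentiable (by norm_num)) (xs i)).hasFDerivAt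
  have e3 := hd.isLittleO.def (half_pos hcl)
  obtain ⟨r, hr, hball⟩ := Metric.eventually_nhds_iff.1 (e1.and (e2.and e3))
  refine ⟨r / 2, half_pos hr, cl / 2 / (P (xs i) + 1), by positivity, fun x hx0 hx => ?_⟩
  obtain ⟨h1, h2, h3⟩ := hball (y := x) (by rw [dist_eq_norm]; linarith)
  rw [hz, sub_zero] at h3
  have h4 := hJ (x - xs i)
  have h5 : cl / 2 * ‖x - xs i‖ ≤ ‖F x‖ := by
    have := norm_sub_norm_le (fderiv ℝ F (xs i) (x - xs i)) (F x)
    rw [norm_sub_rev] at this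
    linarith
  rw [hprodA x, norm_smul, norm_inv, Real.norm_of_nonneg (by positivity), inv_mul_eq_div,
    div_le_div_iff₀ (by positivity) (by positivity)]
  calc cl / 2 * (‖x - xs i‖ * P x) = (cl / 2 * ‖x - xs i‖) * P x := by ring
    _ ≤ ‖F x‖ * (P (xs i) + 1) := by gcongr
end

section
/- (Brown–Gearhart property.) Let F : ℝⁿ → ℝⁿ be continuously differentiable, let x₁*, …, x_k* ∈ ℝⁿ be pairwise distinct, and suppose for some index i ∈ {1, …, k} that F(x_i*) = 0 and ‖J(x_i*) y‖ ≥ c_l ‖y‖ for all y ∈ ℝⁿ with c_l > 0, where J is the Jacobian of F. Define G_k(x) = F(x) / (‖x − x₁*‖ ⋯ ‖x − x_k*‖) for x distinct from all x_j*. Then for every sequence (x_m) with x_m → x_i* and x_m ∉ {x₁*, …, x_k*} for all m, one has liminf_{m → ∞} ‖G_k(x_m)‖ > 0. -/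
lemma norm_inv_mul_smul_aux {E : Type*} [NormedAddCommGroup E] [NormedSpace ℝ E]
    (d p : ℝ) (v : E) (hd : 0 < d) (hp : 0 < p) :
    ‖(d * p)⁻¹ • v‖ = ‖v‖ / d / p := by
  rw [norm_smul, Real.norm_of_nonneg (by positivity)]
  field_simp

/-- Brown–Gearhart property: along any sequence converging to the nondegenerate zero
`x_i*` and avoiding the deflation points, the deflated function
`G_k(x) = F(x)/∏_j ‖x - x_j*‖` has positive liminf of its norm. -/
theorem brown_gearhart_property (n k : ℕ)
    (F : EuclideanSpace ℝ (Fin n) → EuclideanSpace ℝ (Fin n))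
    (xs : Fin k → EuclideanSpace ℝ (Fin n)) (i : Fin k) (cl : ℝ)
    (hF : ContDiff ℝ 1 F) (hcl : 0 < cl) (hz : F (xs i) = 0)
    (hxs : Function.Injective xs)
    (hJ : ∀ y : EuclideanSpace ℝ (Fin n), cl * ‖y‖ ≤ ‖fderiv ℝ F (xs i) y‖)
    (xm : ℕ → EuclideanSpace ℝ (Fin n))
    (hconv : Filter.Tendsto xm Filter.atTop (nhds (xs i)))
    (havoid : ∀ m j, xm m ≠ xs j) :
    0 < Filter.liminf (fun m => ‖(∏ j, ‖xm m - xs j‖)⁻¹ • F (xm m)‖) Filter.atTop := by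
  obtain ⟨P, hP⟩ : ∃ P : EuclideanSpace ℝ (Fin n) → ℝ,
      P = fun x => ∏ j ∈ Finset.univ.erase i, ‖x - xs j‖ := ⟨_, rfl⟩
  have hP0 : 0 < P (xs i) := by
    rw [hP]
    refine Finset.prod_pos fun j hj => ?_
    rw [norm_pos_iff, sub_ne_zero]
    exact fun h => (Finset.ne_of_mem_erase hj) (hxs h).symm
  have hPc : Continuous P := by
    rw [hP]
    fun_prop
  have hPt : Filter.Tendsto (fun m => P (xm m)) Filter.atTop (nhds (P (xs i))) :=
    (hPc.tendsto (xs i)).comp hconv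
  have hlow : ∀ᶠ m in Filter.atTop, P (xs i) / 2 < P (xm m) :=
    hPt.eventually (lt_mem_nhds (by linarith))
  have hup : ∀ᶠ m in Filter.atTop, P (xm m) < 2 * P (xs i) :=
    hPt.eventually (gt_mem_nhds (by linarith))
  have hd : HasFDerivAt F (fderiv ℝ F (xs i)) (xs i) :=
    (hF.differentiable one_ne_zero (xs i)).hasFDerivAt
  have ho := hconv.eventually (hd.isLittleO.def (half_pos hcl))
  have key : ∀ᶠ m in Filter.atTop,
      cl / 2 / (2 * P (xs i)) ≤ ‖(∏ j, ‖xm m - xs j‖)⁻¹ • F (xm m)‖ ∧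
      ‖(∏ j, ‖xm m - xs j‖)⁻¹ • F (xm m)‖
        ≤ (‖fderiv ℝ F (xs i)‖ + cl / 2) / (P (xs i) / 2) := by
    filter_upwards [hlow, hup, ho] with m h1 h2 h3
    have hdpos : 0 < ‖xm m - xs i‖ := by
      rw [norm_pos_iff, sub_ne_zero]
      exact havoid m i
    have hPm : 0 < P (xm m) := by linarith
    have hprod : ∏ j, ‖xm m - xs j‖ = ‖xm m - xs i‖ * P (xm m) := by
      rw [hP]
      exact (Finset.mul_prod_erase Finset.univ (fun j => ‖xm m - xs j‖) (Finset.mem_univ i)).symm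
    rw [hz, sub_zero] at h3
    have h4 := hJ (xm m - xs i)
    have h5 := (fderiv ℝ F (xs i)).le_opNorm (xm m - xs i)
    have h6 := norm_sub_norm_le (fderiv ℝ F (xs i) (xm m - xs i)) (F (xm m))
    have h7 := norm_sub_norm_le (F (xm m)) (fderiv ℝ F (xs i) (xm m - xs i))
    rw [norm_sub_rev] at h6
    have hFl : cl / 2 * ‖xm m - xs i‖ ≤ ‖F (xm m)‖ := by linarith
    have hFu : ‖F (xm m)‖ ≤ (‖fderiv ℝ F (xs i)‖ + cl / 2) * ‖xm m - xs i‖ := by linarith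
    have hu : ‖(∏ j, ‖xm m - xs j‖)⁻¹ • F (xm m)‖
        = ‖F (xm m)‖ / ‖xm m - xs i‖ / P (xm m) := by
      rw [hprod]
      exact norm_inv_mul_smul_aux _ _ _ hdpos hPm
    rw [hu]
    constructor
    · exact div_le_div₀ (by positivity) ((le_div_iff₀ hdpos).2 hFl) hPm h2.le
    · exact div_le_div₀ (by positivity) ((div_le_iff₀ hdpos).2 hFu) (by positivity) h1.le
  have hpos : 0 < cl / 2 / (2 * P (xs i)) := by positivity
  refine hpos.trans_le (Filter.le_liminf_of_le ?_ (key.mono fun m h => h.1))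
  exact Filter.IsBoundedUnder.isCoboundedUnder_ge ⟨_, Filter.eventually_map.2 (key.mono fun m h => h.2)⟩
end

section
/- (Deflation lower bound for the scaled ℓ¹ deflation.) Let F : ℝⁿ → ℝⁿ be continuously differentiable, let x₁*, …, x_k* ∈ ℝⁿ be pairwise distinct, let α₁, …, α_k > 0, and suppose for some index i ∈ {1, …, k} that F(x_i*) = 0 and ‖J(x_i*) y‖ ≥ c_l ‖y‖ for all y ∈ ℝⁿ with c_l > 0, where J is the Jacobian of F and ‖·‖ the Euclidean norm. Define G_k(x) = (∏_{j=1}^{k} α_j / ‖x − x_j*‖₁) · F(x) for x distinct from all x_j*, where ‖·‖₁ is the ℓ¹-norm. Then there exists δ > 0 such that for every x with 0 < ‖x − x_i*‖ ≤ δ, ‖G_k(x)‖ ≥ (c_l / (2 √n)) · (∏_{j=1}^{k} α_j) / (∏_{j ≠ i} ‖x − x_j*‖₁); in particular liminf ‖G_k(x_m)‖ > 0 along any sequence x_m → x_i* avoiding the deflation points. -/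
open Finset in
/-- Deflation lower bound for the scaled ℓ¹ deflation:
near the nondegenerate zero `x_i*` of `F`, the scaled deflated function
`G_k(x) = (∏_j α_j/‖x - x_j*‖₁) • F(x)` satisfies
`‖G_k(x)‖ ≥ (c_l/(2√n)) ∏_j α_j / ∏_{j ≠ i} ‖x - x_j*‖₁`. -/
theorem scaled_deflation_lower_bound (n k : ℕ)
    (F : EuclideanSpace ℝ (Fin n) → EuclideanSpace ℝ (Fin n))
    (xs : Fin k → EuclideanSpace ℝ (Fin n)) (α : Fin k → ℝ) (i : Fin k) (cl : ℝ)
    (hF : ContDiff ℝ 1 F) (hcl : 0 < cl) (hα : ∀ j, 0 < α j)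
    (hxs : Function.Injective xs) (hz : F (xs i) = 0)
    (hJ : ∀ y : EuclideanSpace ℝ (Fin n), cl * ‖y‖ ≤ ‖fderiv ℝ F (xs i) y‖) :
    ∃ δ > 0, ∀ x : EuclideanSpace ℝ (Fin n),
      0 < ‖x - xs i‖ → ‖x - xs i‖ ≤ δ →
        cl / (2 * Real.sqrt n) * (∏ j, α j) /
            (∏ j ∈ univ.erase i, ∑ m, |(x - xs j) m|) ≤
          ‖(∏ j, α j / ∑ m, |(x - xs j) m|) • F x‖ := by
  have hd : HasFDerivAt F (fderiv ℝ F (xs i)) (xs i) :=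
    (hF.differentiable (by norm_num) (xs i)).hasFDerivAt
  have hb := hd.isLittleO.def (half_pos hcl)
  obtain ⟨δ, hδ, hball⟩ := Metric.eventually_nhds_iff.1 hb
  refine ⟨δ / 2, half_pos hδ, fun x hx0 hx => ?_⟩
  have h1 := hball (y := x) (by rw [dist_eq_norm]; linarith)
  rw [hz, sub_zero] at h1
  have h2 := hJ (x - xs i)
  have h3 : cl / 2 * ‖x - xs i‖ ≤ ‖F x‖ := by
    have h4 := norm_sub_norm_le (fderiv ℝ F (xs i) (x - xs i)) (F x)
    rw [norm_sub_rev] at h4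
    linarith
  have hS : ∑ m, |(x - xs i) m| ≤ Real.sqrt n * ‖x - xs i‖ := by
    have h5 := sq_sum_le_card_mul_sum_sq (s := (univ : Finset (Fin n)))
      (f := fun m => |(x - xs i) m|)
    rw [EuclideanSpace.norm_eq, ← Real.sqrt_mul (Nat.cast_nonneg n)]
    apply Real.le_sqrt_of_sq_le
    simpa using h5
  have hSpos : 0 < ∑ m, |(x - xs i) m| := by
    refine lt_of_le_of_ne (sum_nonneg fun m _ => abs_nonneg _) fun h => ?_
    have h6 := (sum_eq_zero_iff_of_nonneg (fun m _ => abs_nonneg ((x - xs i) m))).1 h.symm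
    have h7 : x - xs i = 0 := by
      ext m
      simpa using h6 m (mem_univ m)
    rw [h7, norm_zero] at hx0
    exact lt_irrefl _ hx0
  have hn : 0 < Real.sqrt n := by
    by_contra hcon
    have h8 : Real.sqrt n * ‖x - xs i‖ ≤ 0 :=
      mul_nonpos_of_nonpos_of_nonneg (not_lt.1 hcon) hx0.le
    linarith
  have hA : 0 < ∏ j, α j := prod_pos fun j _ => hα j
  have hP : 0 ≤ ∏ j ∈ univ.erase i, ∑ m, |(x - xs j) m| :=
    prod_nonneg fun j _ => sum_nonneg fun m _ => abs_nonneg _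
  have hmain : cl / (2 * Real.sqrt n) ≤ ‖F x‖ / ∑ m, |(x - xs i) m| := by
    rw [div_le_div_iff₀ (by positivity) hSpos]
    calc cl * ∑ m, |(x - xs i) m| ≤ cl * (Real.sqrt n * ‖x - xs i‖) := by gcongr
      _ = (cl / 2 * ‖x - xs i‖) * (2 * Real.sqrt n) := by ring
      _ ≤ ‖F x‖ * (2 * Real.sqrt n) := by gcongr
  rw [norm_smul, prod_div_distrib, ← mul_prod_erase univ (fun j => ∑ m, |(x - xs j) m|)
    (mem_univ i), Real.norm_of_nonneg (div_nonneg hA.le (mul_nonneg hSpos.le hP))]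
  calc _ ≤ ‖F x‖ / (∑ m, |(x - xs i) m|) * (∏ j, α j) /
            (∏ j ∈ univ.erase i, ∑ m, |(x - xs j) m|) := by gcongr
    _ = _ := by
      simp only [div_eq_mul_inv, mul_inv]
      ring
end

section
/- (Derivative of the scaled deflated function.) Let F : ℝⁿ → ℝⁿ be differentiable, let x₁*, …, x_k* ∈ ℝⁿ, and let α₁, …, α_k > 0. Define G_k(x) = (∏_{j=1}^{k} α_j / ‖x − x_j*‖₁) · F(x), where ‖·‖₁ is the ℓ¹-norm. Suppose x ∈ ℝⁿ is such that for every j ∈ {1, …, k} and every coordinate m ∈ {1, …, n}, the component (x − x_j*)_m is nonzero. Then G_k is differentiable at x and its Fréchet derivative is G_k'(x) = (∏_{j=1}^{k} α_j / ‖x − x_j*‖₁) · ( J(x) + F(x) p(x)ᵀ ), where J(x) is the Fréchet derivative of F at x and p(x) = −∑_{j=1}^{k} sgn(x − x_j*) / ‖x − x_j*‖₁, with sgn applied componentwise. -/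
lemma aux_l1 {n : ℕ} (a x : EuclideanSpace ℝ (Fin n)) (hx : ∀ m, (x - a) m ≠ 0) :
    HasFDerivAt (fun y : EuclideanSpace ℝ (Fin n) => ∑ m, |(y - a) m|)
      (innerSL ℝ ((WithLp.equiv 2 (Fin n → ℝ)).symm (fun m => Real.sign ((x - a) m)))) x := by
  have h : ∀ m ∈ (Finset.univ : Finset (Fin n)),
      HasFDerivAt (fun y : EuclideanSpace ℝ (Fin n) => |(y - a) m|)
      (Real.sign ((x - a) m) • (EuclideanSpace.proj m : EuclideanSpace ℝ (Fin n) →L[ℝ] ℝ)) x := by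
    intro m _
    have h1 : HasFDerivAt (fun y : EuclideanSpace ℝ (Fin n) => (y - a) m)
        (EuclideanSpace.proj m : EuclideanSpace ℝ (Fin n) →L[ℝ] ℝ) x :=
      ((EuclideanSpace.proj m : EuclideanSpace ℝ (Fin n) →L[ℝ] ℝ).hasFDerivAt).sub_const (a m)
    have h2 : HasDerivAt (fun t : ℝ => |t|) (Real.sign ((x - a) m)) ((x - a) m) := by
      rcases lt_or_gt_of_ne (hx m) with h | h
      · rw [Real.sign_of_neg h]; exact hasDerivAt_abs_neg h
      · rw [Real.sign_of_pos h]; exact hasDerivAt_abs_pos h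
    exact h2.comp_hasFDerivAt x h1
  refine (HasFDerivAt.fun_sum h).congr_fderiv ?_
  ext v
  simp [PiLp.inner_apply, mul_comm]

lemma aux_prod {E ι : Type*} [NormedAddCommGroup E] [NormedSpace ℝ E] 
    (s : Finset ι) (g : ι → E → ℝ) (q : ι → E →L[ℝ] ℝ) (x : E)
    (h : ∀ j, HasFDerivAt (g j) (g j x • q j) x) :
    HasFDerivAt (fun y => ∏ j ∈ s, g j y) ((∏ j ∈ s, g j x) • ∑ j ∈ s, q j) x := by
  classical
  induction s using Finset.induction_on with
  | empty => simpa using hasFDerivAt_const (1 : ℝ) x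
  | insert i s hi ih =>
    simp only [Finset.prod_insert hi, Finset.sum_insert hi]
    refine ((h i).mul ih).congr_fderiv ?_
    ext v
    simp
    ring

/-- Derivative of the scaled deflated function: at any point whose coordinates all
differ from those of the deflation points, `G_k(x) = (∏_j α_j/‖x - x_j*‖₁) • F(x)`
is differentiable with derivative
`(∏_j α_j/‖x - x_j*‖₁) • (J(x) + F(x) p(x)ᵀ)`, where
`p(x) = -∑_j sgn(x - x_j*)/‖x - x_j*‖₁`. -/
theorem scaled_deflation_derivative (n k : ℕ)
    (F : EuclideanSpace ℝ (Fin n) → EuclideanSpace ℝ (Fin n))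
    (xs : Fin k → EuclideanSpace ℝ (Fin n)) (α : Fin k → ℝ)
    (hα : ∀ j, 0 < α j) (hF : Differentiable ℝ F)
    (x : EuclideanSpace ℝ (Fin n))
    (hx : ∀ (j : Fin k) (m : Fin n), (x - xs j) m ≠ 0) :
    HasFDerivAt (fun y : EuclideanSpace ℝ (Fin n) =>
        (∏ j, α j / ∑ m, |(y - xs j) m|) • F y)
      ((∏ j, α j / ∑ m, |(x - xs j) m|) •
        (fderiv ℝ F x +
          (innerSL ℝ
            (-(∑ j, (∑ m, |(x - xs j) m|)⁻¹ •
              (WithLp.equiv 2 (Fin n → ℝ)).symm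
                (fun m => Real.sign ((x - xs j) m))))).smulRight (F x))) x := by
  rcases Nat.eq_zero_or_pos n with rfl | hn
  · exact hasFDerivAt_of_subsingleton _ _ |>.congr_fderiv (Subsingleton.elim _ _)
  have hN : ∀ j, ∑ m, |(x - xs j) m| ≠ 0 := by
    intro j
    have : 0 < ∑ m, |(x - xs j) m| :=
      Finset.sum_pos (fun m _ => abs_pos.mpr (hx j m)) ⟨⟨0, hn⟩, Finset.mem_univ _⟩
    exact this.ne'
  have hg := aux_prod Finset.univ (fun j y => α j / ∑ m, |(y - xs j) m|)
    (fun j => -((∑ m, |(x - xs j) m|)⁻¹ • innerSL ℝ ((WithLp.equiv 2 (Fin n → ℝ)).symm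
                (fun m => Real.sign ((x - xs j) m))))) x (by
      intro j
      have h1 := ((hasDerivAt_inv (hN j)).comp_hasFDerivAt x
        (aux_l1 (xs j) x (hx j))).const_mul (α j)
      simp only [div_eq_mul_inv]
      refine h1.congr_fderiv ?_
      ext1 v
      simp only [neg_apply, smul_apply, smul_eq_mul]
      ring)
  refine (hg.smul (hF x).hasFDerivAt).congr_fderiv ?_
  ext1 v
  simp only [map_neg, map_sum, map_smul, Finset.sum_neg_distrib, add_apply,
    smul_apply, ContinuousLinearMap.smulRight_apply, smul_add, smul_smul,
    smul_eq_mul]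
end
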